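/- Define the decoding radius τ_max(ℓ,s) = ⌊(2ℓ − s + 1)/(2(ℓ+1))·n − (ℓ/(2s))·γ + ℓ/(s(ℓ+1))⌋. Suppose γ ≥ 2g − 2, 1 ≤ s ≤ ℓ and ρ ≥ 1, and let τ be a nonnegative integer with τ > τ_max(ℓ,s). Then with λ_s = sτ + g, the quantities ν and ε satisfy ν > ε + 1 (so the linearized key-equation system has at least two linearly independent solutions and the power decoder fails when the error locator degree is sτ + g). -/

import Mathlib

open scoped Classical

/-- An abstract algebraic function field `F` over the base field `𝔽`, together with its
places (with their additive valuations, degrees and residue evaluation maps),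
its Riemann–Roch spaces `L A` for divisors `A` (finitely supported `ℤ`-valued
functions on places), and its genus `g`, axiomatized by the standard properties,
including Riemann's inequality and the exact dimension formula for divisors of
large degree. -/
structure FnFld (𝔽 F : Type) [Field 𝔽] [Field F] [Algebra 𝔽 F] where
  /-- the places of `F` -/
  Place : Type
  /-- the (additive, surjective onto `ℤ`) valuation attached to a place -/
  v : Place → F → WithTop ℤ
  v_zero : ∀ P, v P 0 = ⊤
  v_ne_top : ∀ P (x : F), x ≠ 0 → v P x ≠ ⊤
  v_mul : ∀ P (x y : F), v P (x * y) = v P x + v P y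
  v_add : ∀ P (x y : F), min (v P x) (v P y) ≤ v P (x + y)
  v_surj : ∀ P (m : ℤ), ∃ x : F, v P x = (m : WithTop ℤ)
  v_const : ∀ P (c : 𝔽), c ≠ 0 → v P (algebraMap 𝔽 F c) = 0
  v_finite : ∀ x : F, x ≠ 0 → {P | v P x ≠ 0}.Finite
  /-- the degree of a place -/
  pdeg : Place → ℕ
  pdeg_pos : ∀ P, 0 < pdeg P
  /-- evaluation of a function at a (rational) place; junk value unless
  `pdeg P = 1` and `0 ≤ v P x` -/
  ev : Place → F → 𝔽
  ev_add : ∀ P (x y : F), pdeg P = 1 → 0 ≤ v P x → 0 ≤ v P y →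
    ev P (x + y) = ev P x + ev P y
  ev_mul : ∀ P (x y : F), pdeg P = 1 → 0 ≤ v P x → 0 ≤ v P y →
    ev P (x * y) = ev P x * ev P y
  ev_const : ∀ P (c : 𝔽), ev P (algebraMap 𝔽 F c) = c
  ev_eq_zero_iff : ∀ P (x : F), pdeg P = 1 → 0 ≤ v P x → (ev P x = 0 ↔ 0 < v P x)
  /-- the Riemann–Roch space of a divisor `A`:
  `L A = {x ∈ F \ {0} : (x) ≥ -A} ∪ {0}` -/
  L : (Place →₀ ℤ) → Submodule 𝔽 F
  mem_L : ∀ (A : Place →₀ ℤ) (x : F), x ∈ L A ↔ ∀ P, ((-(A P) : ℤ) : WithTop ℤ) ≤ v P x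
  finiteDim : ∀ A, FiniteDimensional 𝔽 (L A)
  /-- the genus -/
  g : ℕ
  /-- Riemann's inequality : `𝔩(A) ≥ deg A + 1 - g` -/
  riemann : ∀ A : Place →₀ ℤ,
    (A.sum fun P m => m * pdeg P) + 1 - g ≤ (Module.finrank 𝔽 (L A) : ℤ)
  /-- `𝔩(A) = deg A + 1 - g` whenever `deg A ≥ 2g - 1` -/
  dim_L_eq : ∀ A : Place →₀ ℤ, 2 * (g : ℤ) - 1 ≤ (A.sum fun P m => m * pdeg P) →
    (Module.finrank 𝔽 (L A) : ℤ) = (A.sum fun P m => m * pdeg P) + 1 - g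

namespace FnFld

variable {𝔽 F : Type} [Field 𝔽] [Field F] [Algebra 𝔽 F] (K : FnFld 𝔽 F)

/-- The degree of a divisor. -/
def deg (A : K.Place →₀ ℤ) : ℤ := A.sum fun P m => m * K.pdeg P

/-- `𝔩(A)`, the `𝔽`-dimension of the Riemann–Roch space `L(A)`. -/
noncomputable def dimL (A : K.Place →₀ ℤ) : ℕ := Module.finrank 𝔽 (K.L A)

/-- A place is rational if it has degree one. -/
def IsRational (P : K.Place) : Prop := K.pdeg P = 1

/-- The divisor consisting of a single (simple) place. -/
noncomputable def onePt (P : K.Place) : K.Place →₀ ℤ := Finsupp.single P 1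

/-- `R` is an `r`-interpolator of degree `ρ`:
`R ∈ L(G + ρ P∞) \ L(G + (ρ-1) P∞)` and `R(Pᵢ) = rᵢ` for all `i`. -/
def IsInterpolator {n : ℕ} (P : Fin n → K.Place) (Pinf : K.Place)
    (G : K.Place →₀ ℤ) (r : Fin n → 𝔽) (ρ : ℤ) (R : F) : Prop :=
  R ∈ K.L (G + ρ • K.onePt Pinf) ∧ R ∉ K.L (G + (ρ - 1) • K.onePt Pinf) ∧
    ∀ i, K.ev (P i) R = r i

/-- `Λ` is an error locator with multiplicity `s` and degree `lam` (w.r.t. the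
error divisor `E`): `Λ ∈ L(lam P∞ - s E) \ L((lam - 1) P∞ - s E)`. -/
def IsErrLocator (Pinf : K.Place) (E : K.Place →₀ ℤ) (s : ℕ) (lam : ℤ) (Λ : F) : Prop :=
  Λ ∈ K.L (lam • K.onePt Pinf - (s : ℤ) • E) ∧
    Λ ∉ K.L ((lam - 1) • K.onePt Pinf - (s : ℤ) • E)

/-- The divisor `V_t = λ_s P∞ + t G`. -/
noncomputable def Vdiv (Pinf : K.Place) (G : K.Place →₀ ℤ) (lam : ℤ) (t : ℕ) :
    K.Place →₀ ℤ := lam • K.onePt Pinf + (t : ℤ) • G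

/-- The divisor `Q_t = λ_s P∞ + t (G + ρ P∞)`. -/
noncomputable def Qdiv (Pinf : K.Place) (G : K.Place →₀ ℤ) (lam ρ : ℤ) (t : ℕ) :
    K.Place →₀ ℤ := lam • K.onePt Pinf + (t : ℤ) • (G + ρ • K.onePt Pinf)

/-- The divisor `W_j = λ_s P∞ + j (G + ρ P∞ - D)`. -/
noncomputable def Wdiv (Pinf : K.Place) (G D : K.Place →₀ ℤ) (lam ρ : ℤ) (j : ℕ) :
    K.Place →₀ ℤ := lam • K.onePt Pinf + (j : ℤ) • (G + ρ • K.onePt Pinf - D)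

end FnFld
namespace FnFld

variable {𝔽 F : Type} [Field 𝔽] [Field F] [Algebra 𝔽 F] (K : FnFld 𝔽 F)

theorem deg_zero : K.deg 0 = 0 := Finsupp.sum_zero_index

theorem deg_add (A B : K.Place →₀ ℤ) : K.deg (A + B) = K.deg A + K.deg B :=
  Finsupp.sum_add_index' (fun _ => by simp) (fun _ _ _ => by ring)

theorem deg_zsmul (m : ℤ) (A : K.Place →₀ ℤ) : K.deg (m • A) = m * K.deg A := by
  simpa using map_zsmul
    ({ toFun := K.deg, map_zero' := K.deg_zero, map_add' := K.deg_add } :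
      (K.Place →₀ ℤ) →+ ℤ) m A

theorem deg_sub (A B : K.Place →₀ ℤ) : K.deg (A - B) = K.deg A - K.deg B := by
  have h := K.deg_add (A - B) B
  rw [sub_add_cancel] at h
  linarith

theorem deg_onePt {P : K.Place} (hP : K.IsRational P) : K.deg (K.onePt P) = 1 := by
  rw [IsRational] at hP
  simp [deg, onePt, hP]

theorem deg_sum_onePt {n : ℕ} (P : Fin n → K.Place) (hP : ∀ i, K.IsRational (P i)) :
    K.deg (∑ i, K.onePt (P i)) = n := by
  refine (map_sum
    ({ toFun := K.deg, map_zero' := K.deg_zero, map_add' := K.deg_add } :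
      (K.Place →₀ ℤ) →+ ℤ) (fun i => K.onePt (P i)) Finset.univ).trans ?_
  simp [K.deg_onePt (hP _)]

theorem deg_add_one_sub_genus_le_dimL (A : K.Place →₀ ℤ) :
    K.deg A + 1 - K.g ≤ (K.dimL A : ℤ) := K.riemann A

theorem dimL_eq {A : K.Place →₀ ℤ} (h : 2 * (K.g : ℤ) - 1 ≤ K.deg A) :
    (K.dimL A : ℤ) = K.deg A + 1 - K.g := K.dim_L_eq A h

theorem deg_Vdiv {Pinf : K.Place} (hPinf : K.IsRational Pinf)
    (G : K.Place →₀ ℤ) (lam : ℤ) (t : ℕ) :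
    K.deg (K.Vdiv Pinf G lam t) = lam + t * K.deg G := by
  rw [Vdiv, deg_add, deg_zsmul, deg_zsmul, K.deg_onePt hPinf, mul_one]

theorem deg_Qdiv {Pinf : K.Place} (hPinf : K.IsRational Pinf)
    (G : K.Place →₀ ℤ) (lam ρ : ℤ) (t : ℕ) :
    K.deg (K.Qdiv Pinf G lam ρ t) = lam + t * (K.deg G + ρ) := by
  rw [Qdiv, deg_add, deg_zsmul, deg_zsmul, deg_add, deg_zsmul, K.deg_onePt hPinf, mul_one,
    mul_one]

theorem deg_Wdiv {Pinf : K.Place} (hPinf : K.IsRational Pinf)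
    (G D : K.Place →₀ ℤ) (lam ρ : ℤ) (j : ℕ) :
    K.deg (K.Wdiv Pinf G D lam ρ j) = lam + j * (K.deg G + ρ - K.deg D) := by
  rw [Wdiv, deg_add, deg_zsmul, deg_zsmul, deg_sub, deg_add, deg_zsmul, K.deg_onePt hPinf,
    mul_one, mul_one]

end FnFld

theorem two_mul_sum_Icc_affine (a b : ℤ) (m : ℕ) :
    2 * ∑ t ∈ Finset.Icc 1 m, (a + t * b) = 2 * m * a + m * (m + 1) * b := by
  induction m with
  | zero => simp
  | succ k ih =>
    rw [Finset.sum_Icc_succ_top (by omega), mul_add, ih]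
    push_cast
    ring

theorem sum_range_eq_zero_add_sum_Icc (f : ℕ → ℤ) {s : ℕ} (hs : 1 ≤ s) :
    ∑ j ∈ Finset.range s, f j = f 0 + ∑ t ∈ Finset.Icc 1 (s - 1), f t := by
  obtain ⟨k, rfl⟩ := Nat.exists_eq_add_of_le' hs
  rw [Nat.add_sub_cancel, Finset.sum_range_succ', add_comm, Finset.range_eq_Ico,
    Finset.sum_Ico_add' f 0 k 1]
  rfl

theorem decoding_radius_lt_cleared {n s ℓ τ : ℕ} {γ : ℤ} (hs : 1 ≤ s)
    (h : ⌊(2 * (ℓ : ℚ) - s + 1) / (2 * (ℓ + 1)) * n - (ℓ : ℚ) / (2 * s) * γ +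
      (ℓ : ℚ) / (s * (ℓ + 1))⌋ < (τ : ℤ)) :
    (s : ℤ) * n * (2 * ℓ - s + 1) - ℓ * (ℓ + 1) * γ + 2 * ℓ < 2 * (ℓ + 1) * (s * τ) := by
  rw [Int.floor_lt] at h
  have hs' : (0 : ℚ) < s := by exact_mod_cast hs
  have hℓ : (0 : ℚ) < (ℓ : ℚ) + 1 := by positivity
  have h' := mul_lt_mul_of_pos_left h (show (0 : ℚ) < 2 * (ℓ + 1) * s by positivity)
  have e : 2 * ((ℓ : ℚ) + 1) * s * ((2 * (ℓ : ℚ) - s + 1) / (2 * (ℓ + 1)) * n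
      - (ℓ : ℚ) / (2 * s) * γ + (ℓ : ℚ) / (s * (ℓ + 1)))
      = (s : ℚ) * n * (2 * ℓ - s + 1) - ℓ * (ℓ + 1) * γ + 2 * ℓ := by
    field_simp
  rw [e] at h'
  have h'' : (s : ℚ) * n * (2 * ℓ - s + 1) - ℓ * (ℓ + 1) * γ + 2 * ℓ
      < 2 * (ℓ + 1) * (s * τ) := by
    push_cast at h'
    linarith
  exact_mod_cast h''

/-- With the decoding radius
`τ_max(ℓ,s) = ⌊(2ℓ - s + 1)/(2(ℓ+1))·n - (ℓ/(2s))·γ + ℓ/(s(ℓ+1))⌋`, if `τ > τ_max(ℓ,s)`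
then with `λ_s = sτ + g` the quantities `ν` and `ε` satisfy `ν > ε + 1` (so the
linearized key-equation system has at least two linearly independent solutions and the
power decoder fails when the error locator degree is `sτ + g`). -/
theorem failure_beyond_decoding_radius
    {𝔽 F : Type} [Field 𝔽] [Field F] [Algebra 𝔽 F] (K : FnFld 𝔽 F)
    (n : ℕ) (P : Fin n → K.Place) (Pinf : K.Place)
    (hPrat : ∀ i, K.IsRational (P i)) (hPinfrat : K.IsRational Pinf)
    (hPinj : Function.Injective P) (hPne : ∀ i, P i ≠ Pinf)
    (G : K.Place →₀ ℤ) (γ : ℤ) (hG : K.deg G = γ) (hγ : 2 * (K.g : ℤ) - 2 ≤ γ)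
    (hGP : ∀ i, G (P i) = 0) (hGinf : G Pinf = 0)
    (D : K.Place →₀ ℤ) (hD : D = ∑ i, K.onePt (P i))
    (s ℓ : ℕ) (hs : 1 ≤ s) (hsℓ : s ≤ ℓ) (ρ : ℤ) (hρ : 1 ≤ ρ)
    (τmax : ℤ)
    (hτmax : τmax = ⌊(2 * (ℓ : ℚ) - s + 1) / (2 * (ℓ + 1)) * n - (ℓ : ℚ) / (2 * s) * γ +
      (ℓ : ℚ) / (s * (ℓ + 1))⌋)
    (τ : ℕ) (hτ : (τ : ℤ) > τmax)
    (lam : ℤ) (hlamdef : lam = (s : ℤ) * τ + K.g)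
    (ν ε : ℤ)
    (hν : ν = (∑ t ∈ Finset.Icc 1 ℓ, (K.dimL (K.Vdiv Pinf G lam t) : ℤ)) +
      ∑ j ∈ Finset.range s, (K.dimL (K.Wdiv Pinf G D lam ρ j) : ℤ))
    (hε : ε = (∑ t ∈ Finset.Icc 1 (s - 1), (K.dimL (K.Qdiv Pinf G lam ρ t) : ℤ)) +
      ∑ t ∈ Finset.Icc s ℓ,
        ((K.dimL (K.Qdiv Pinf G lam ρ t) : ℤ) -
          (K.dimL (K.Qdiv Pinf G lam ρ t - (s : ℤ) • D) : ℤ))) :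
    ν > ε + 1 := by
  subst hlamdef hτmax
  have key := decoding_radius_lt_cleared hs hτ
  have hsℓ' : (s : ℤ) ≤ ℓ := by exact_mod_cast hsℓ
  have hs' : (1 : ℤ) ≤ s := by exact_mod_cast hs
  have hdegD : K.deg D = n := hD ▸ K.deg_sum_onePt P hPrat
  have hsτ : (0 : ℤ) ≤ s * τ := by positivity
  have hQdeg : ∀ t : ℕ, 1 ≤ t → t ≤ ℓ →
      2 * (K.g : ℤ) - 1 ≤ s * τ + K.g + t * (γ + ρ) := by
    intro t ht htℓ
    have ht' : (1 : ℤ) ≤ t := by exact_mod_cast ht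
    have htℓ' : (t : ℤ) ≤ ℓ := by exact_mod_cast htℓ
    by_cases hneg : 0 ≤ γ + ρ
    · nlinarith
    · have hg : (K.g : ℤ) = 0 := by omega
      have hγ2 : γ = -2 := by omega
      have hρ1 : ρ = 1 := by omega
      subst hγ2 hρ1
      have hn : (0 : ℤ) ≤ s * n * (2 * ℓ - s + 1) := by
        have : (0 : ℤ) ≤ 2 * ℓ - s + 1 := by omega
        positivity
      have : (ℓ : ℤ) < s * τ := by nlinarith
      rw [hg]
      linarith
  have hQ : ∀ t : ℕ, 1 ≤ t → t ≤ ℓ → (K.dimL (K.Qdiv Pinf G (s * τ + K.g) ρ t) : ℤ) =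
      (s * τ + 1) + t * (γ + ρ) := by
    intro t ht htℓ
    have hd := K.deg_Qdiv hPinfrat G (s * τ + K.g) ρ t
    rw [hG] at hd
    rw [K.dimL_eq (hd ▸ hQdeg t ht htℓ), hd]
    ring
  have hV : ∑ t ∈ Finset.Icc 1 ℓ, (((s : ℤ) * τ + 1) + t * γ) ≤
      ∑ t ∈ Finset.Icc 1 ℓ, (K.dimL (K.Vdiv Pinf G (s * τ + K.g) t) : ℤ) := by
    refine Finset.sum_le_sum fun t _ => ?_
    have h := K.deg_add_one_sub_genus_le_dimL (K.Vdiv Pinf G (s * τ + K.g) t)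
    rw [K.deg_Vdiv hPinfrat, hG] at h
    linarith
  have hW : ∑ j ∈ Finset.range s, (((s : ℤ) * τ + 1) + j * (γ + ρ - n)) ≤
      ∑ j ∈ Finset.range s, (K.dimL (K.Wdiv Pinf G D (s * τ + K.g) ρ j) : ℤ) := by
    refine Finset.sum_le_sum fun j _ => ?_
    have h := K.deg_add_one_sub_genus_le_dimL (K.Wdiv Pinf G D (s * τ + K.g) ρ j)
    rw [K.deg_Wdiv hPinfrat, hG, hdegD] at h
    linarith
  have hQlow : ∑ t ∈ Finset.Icc 1 (s - 1), (K.dimL (K.Qdiv Pinf G (s * τ + K.g) ρ t) : ℤ) =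
      ∑ t ∈ Finset.Icc 1 (s - 1), (((s : ℤ) * τ + 1) + t * (γ + ρ)) := by
    refine Finset.sum_congr rfl fun t ht => ?_
    rw [Finset.mem_Icc] at ht
    exact hQ t ht.1 (by omega)
  have hQhigh : ∑ t ∈ Finset.Icc s ℓ, ((K.dimL (K.Qdiv Pinf G (s * τ + K.g) ρ t) : ℤ) -
      (K.dimL (K.Qdiv Pinf G (s * τ + K.g) ρ t - (s : ℤ) • D) : ℤ)) ≤
      (ℓ + 1 - s) * (s * n) := by
    refine (Finset.sum_le_card_nsmul _ _ ((s : ℤ) * n) fun t ht => ?_).trans_eq ?_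
    · rw [Finset.mem_Icc] at ht
      have h := K.deg_add_one_sub_genus_le_dimL
        (K.Qdiv Pinf G (s * τ + K.g) ρ t - (s : ℤ) • D)
      rw [K.deg_sub, K.deg_zsmul, K.deg_Qdiv hPinfrat, hG, hdegD] at h
      rw [hQ t (hs.trans ht.1) ht.2]
      linarith
    · rw [Nat.card_Icc, nsmul_eq_mul, Nat.cast_sub (by omega)]
      push_cast
      ring
  have eV := two_mul_sum_Icc_affine ((s : ℤ) * τ + 1) γ ℓ
  have eW := two_mul_sum_Icc_affine ((s : ℤ) * τ + 1) (γ + ρ - n) (s - 1)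
  have eQ := two_mul_sum_Icc_affine ((s : ℤ) * τ + 1) (γ + ρ) (s - 1)
  rw [sum_range_eq_zero_add_sum_Icc _ hs] at hW
  rw [Nat.cast_sub hs] at eW eQ
  push_cast at eW eQ hW
  rw [hQlow] at hε
  rw [hν, hε]
  nlinarith
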